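/- arXiv:0902.0130 — 2 statements merged into one kernel-verified Lean document; each statement's English description precedes it below -/
import Mathlib

section
/- For the KKM potential V_I, each of the five integrals is in involution with the Hamiltonian: {H,A₁} = {H,A₂} = {H,B₁} = {H,B₂} = {H,F} = 0. -/
noncomputable section

open MvPolynomial

/-- The field of rational functions over ℝ in the six variables
`x, y, z, p_x, p_y, p_z`: the fraction field of the polynomial ring. -/
abbrev K6 : Type := FractionRing (MvPolynomial (Fin 6) ℝ)

/-- The canonical embedding of the polynomial ring into its fraction field. -/
def toK6 : MvPolynomial (Fin 6) ℝ →+* K6 :=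
  algebraMap (MvPolynomial (Fin 6) ℝ) K6

/-- Constants, embedded in `K6`. -/
def cR (a : ℝ) : K6 := toK6 (MvPolynomial.C a)

def vx : K6 := toK6 (MvPolynomial.X 0)
def vy : K6 := toK6 (MvPolynomial.X 1)
def vz : K6 := toK6 (MvPolynomial.X 2)
def vpx : K6 := toK6 (MvPolynomial.X 3)
def vpy : K6 := toK6 (MvPolynomial.X 4)
def vpz : K6 := toK6 (MvPolynomial.X 5)

/-- `D` is the (unique) extension to the fraction field of the formal partial
derivative `pderiv j` on the polynomial ring: an additive map satisfying the
Leibniz rule which agrees with `pderiv j` on polynomials. -/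
def IsPDeriv (j : Fin 6) (D : K6 → K6) : Prop :=
  (∀ f g : K6, D (f + g) = D f + D g) ∧
  (∀ f g : K6, D (f * g) = D f * g + f * D g) ∧
  (∀ p, D (toK6 p) = toK6 (pderiv j p))

/-- The canonical Poisson bracket on `K6`, where `Pd 0, …, Pd 5` are the
partial derivatives with respect to `x, y, z, p_x, p_y, p_z` respectively:
`{f,g} = f_x g_{p_x} + f_y g_{p_y} + f_z g_{p_z}
  - f_{p_x} g_x - f_{p_y} g_y - f_{p_z} g_z`. -/
def poisson (Pd : Fin 6 → K6 → K6) (f g : K6) : K6 :=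
  Pd 0 f * Pd 3 g + Pd 1 f * Pd 4 g + Pd 2 f * Pd 5 g
    - Pd 3 f * Pd 0 g - Pd 4 f * Pd 1 g - Pd 5 f * Pd 2 g

/-- Angular momentum `J_x = y p_z - z p_y`. -/
def Jx : K6 := vy * vpz - vz * vpy
/-- Angular momentum `J_y = z p_x - x p_z`. -/
def Jy : K6 := vz * vpx - vx * vpz
/-- Angular momentum `J_z = x p_y - y p_x`. -/
def Jz : K6 := vx * vpy - vy * vpx
/-- Total angular momentum squared `J² = J_x² + J_y² + J_z²`. -/
def Jsq : K6 := Jx ^ 2 + Jy ^ 2 + Jz ^ 2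

/-- KKM V_I Hamiltonian. -/
def HV (α₁ α₂ α₃ δ : ℝ) : K6 :=
  vpx ^ 2 + vpy ^ 2 + vpz ^ 2 + cR δ * (vx ^ 2 + vy ^ 2 + vz ^ 2)
    + cR α₁ / vx ^ 2 + cR α₂ / vy ^ 2 + cR α₃ / vz ^ 2

def A1V (α₁ δ : ℝ) : K6 := vpx ^ 2 + cR δ * vx ^ 2 + cR α₁ / vx ^ 2

def A2V (α₃ δ : ℝ) : K6 := vpz ^ 2 + cR δ * vz ^ 2 + cR α₃ / vz ^ 2

def B1V (α₁ α₂ : ℝ) : K6 :=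
  Jz ^ 2 + cR α₂ * vx ^ 2 / vy ^ 2 + cR α₁ * vy ^ 2 / vx ^ 2

def B2V (α₂ α₃ : ℝ) : K6 :=
  Jx ^ 2 + cR α₃ * vy ^ 2 / vz ^ 2 + cR α₂ * vz ^ 2 / vy ^ 2

def FV (α₁ α₂ α₃ : ℝ) : K6 :=
  Jsq + cR α₂ * (vx ^ 2 + vz ^ 2) / vy ^ 2
    + (cR α₃ * vx ^ 2 * (vx ^ 2 + vy ^ 2) + cR α₁ * vz ^ 2 * (vy ^ 2 + vz ^ 2))
      / (vx ^ 2 * vz ^ 2)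

/-- An additive map on a field satisfying the Leibniz rule, bundled as a derivation. -/
def derivationOfLeibniz {L : Type*} [Field L] (D : L → L) (hadd : ∀ f g, D (f + g) = D f + D g)
    (hmul : ∀ f g, D (f * g) = D f * g + f * D g) : Derivation ℤ L L :=
  Derivation.mk' (AddMonoidHom.mk' D hadd).toIntLinearMap fun a b => by
    simp only [AddMonoidHom.coe_toIntLinearMap, AddMonoidHom.mk'_apply, smul_eq_mul, hmul]
    ring

namespace IsPDeriv

variable {j : Fin 6} {D : K6 → K6}

/-- A partial derivative on `K6`, bundled as a derivation. -/
def toDerivation (h : IsPDeriv j D) := derivationOfLeibniz D h.1 h.2.1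

theorem toDerivation_apply (h : IsPDeriv j D) (f : K6) : h.toDerivation f = D f := rfl

theorem map_const (h : IsPDeriv j D) (a : ℝ) : D (cR a) = 0 := by
  rw [cR, h.2.2, pderiv_C, map_zero]

theorem map_X (h : IsPDeriv j D) (i : Fin 6) :
    D (toK6 (X i)) = if i = j then 1 else 0 := by
  rw [h.2.2, pderiv_X, Pi.single_apply]
  split_ifs <;> simp_all

end IsPDeriv

section Gradients

variable {L : Type*} [Field L] (D : Derivation ℤ L L) (x y z p q r a b c d : L)

theorem derivation_hamiltonian (hx : x ≠ 0) (hy : y ≠ 0) (hz : z ≠ 0)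
    (ha : D a = 0) (hb : D b = 0) (hc : D c = 0) (hd : D d = 0) :
    D (p ^ 2 + q ^ 2 + r ^ 2 + d * (x ^ 2 + y ^ 2 + z ^ 2) + a / x ^ 2 + b / y ^ 2 + c / z ^ 2) =
      2 * (p * D p + q * D q + r * D r + (d * x - a / x ^ 3) * D x
        + (d * y - b / y ^ 3) * D y + (d * z - c / z ^ 3) * D z) := by
  simp only [map_add, Derivation.leibniz, Derivation.leibniz_pow, Derivation.leibniz_div,
    ha, hb, hc, hd, smul_eq_mul, nsmul_eq_mul]
  field_simp
  push_cast
  ring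

theorem derivation_oscillator (hx : x ≠ 0) (ha : D a = 0) (hd : D d = 0) :
    D (p ^ 2 + d * x ^ 2 + a / x ^ 2) = 2 * (p * D p + (d * x - a / x ^ 3) * D x) := by
  simp only [map_add, Derivation.leibniz, Derivation.leibniz_pow, Derivation.leibniz_div,
    ha, hd, smul_eq_mul, nsmul_eq_mul]
  field_simp
  push_cast
  ring

theorem derivation_rotation (hx : x ≠ 0) (hy : y ≠ 0) (ha : D a = 0) (hb : D b = 0) :
    D ((x * q - y * p) ^ 2 + b * x ^ 2 / y ^ 2 + a * y ^ 2 / x ^ 2) =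
      2 * ((x * q - y * p) * (q * D x + x * D q - p * D y - y * D p)
        + (b * x / y ^ 2 - a * y ^ 2 / x ^ 3) * D x
        + (a * y / x ^ 2 - b * x ^ 2 / y ^ 3) * D y) := by
  simp only [map_add, map_sub, Derivation.leibniz, Derivation.leibniz_pow, Derivation.leibniz_div,
    ha, hb, smul_eq_mul, nsmul_eq_mul]
  field_simp
  push_cast
  ring

end Gradients

theorem toK6_X_ne_zero (i : Fin 6) : toK6 (X i) ≠ 0 := by
  simp [toK6, X_ne_zero]

/-- The integral `F` is the sum of the three planar integrals, each a squared angular momentum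
plus its potential. -/
theorem FV_eq (α₁ α₂ α₃ : ℝ) :
    FV α₁ α₂ α₃ = B1V α₁ α₂ + B2V α₂ α₃
      + ((vz * vpx - vx * vpz) ^ 2 + cR α₁ * vz ^ 2 / vx ^ 2 + cR α₃ * vx ^ 2 / vz ^ 2) := by
  have hx : vx ≠ 0 := toK6_X_ne_zero 0
  have hz : vz ≠ 0 := toK6_X_ne_zero 2
  simp only [FV, B1V, B2V, Jsq, Jy]
  field_simp
  ring

theorem poisson_add_right {Pd : Fin 6 → K6 → K6} (hPd : ∀ j, IsPDeriv j (Pd j)) (f g h : K6) :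
    poisson Pd f (g + h) = poisson Pd f g + poisson Pd f h := by
  simp only [poisson, (hPd _).1]
  ring

theorem kkm_VI_involution (α₁ α₂ α₃ δ : ℝ) (Pd : Fin 6 → K6 → K6)
    (hPd : ∀ j, IsPDeriv j (Pd j))
    (H A1 A2 B1 B2 F : K6)
    (hH : H = HV α₁ α₂ α₃ δ) (hA1 : A1 = A1V α₁ δ) (hA2 : A2 = A2V α₃ δ)
    (hB1 : B1 = B1V α₁ α₂) (hB2 : B2 = B2V α₂ α₃) (hF : F = FV α₁ α₂ α₃) :
    poisson Pd H A1 = 0 ∧ poisson Pd H A2 = 0 ∧ poisson Pd H B1 = 0 ∧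
      poisson Pd H B2 = 0 ∧ poisson Pd H F = 0 := by
  have hx : vx ≠ 0 := toK6_X_ne_zero 0
  have hy : vy ≠ 0 := toK6_X_ne_zero 1
  have hz : vz ≠ 0 := toK6_X_ne_zero 2
  have c (j : Fin 6) (a : ℝ) : (hPd j).toDerivation (cR a) = 0 := (hPd j).map_const a
  have dx (j : Fin 6) : Pd j vx = if 0 = j then 1 else 0 := (hPd j).map_X 0
  have dy (j : Fin 6) : Pd j vy = if 1 = j then 1 else 0 := (hPd j).map_X 1
  have dz (j : Fin 6) : Pd j vz = if 2 = j then 1 else 0 := (hPd j).map_X 2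
  have dpx (j : Fin 6) : Pd j vpx = if 3 = j then 1 else 0 := (hPd j).map_X 3
  have dpy (j : Fin 6) : Pd j vpy = if 4 = j then 1 else 0 := (hPd j).map_X 4
  have dpz (j : Fin 6) : Pd j vpz = if 5 = j then 1 else 0 := (hPd j).map_X 5
  have dH (j : Fin 6) := derivation_hamiltonian (hPd j).toDerivation vx vy vz vpx vpy vpz
    _ _ _ _ hx hy hz (c j α₁) (c j α₂) (c j α₃) (c j δ)
  have dA1 (j : Fin 6) := derivation_oscillator (hPd j).toDerivation vx vpx _ _ hx
    (c j α₁) (c j δ)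
  have dA2 (j : Fin 6) := derivation_oscillator (hPd j).toDerivation vz vpz _ _ hz
    (c j α₃) (c j δ)
  have dB1 (j : Fin 6) := derivation_rotation (hPd j).toDerivation vx vy vpx vpy _ _ hx hy
    (c j α₁) (c j α₂)
  have dB2 (j : Fin 6) := derivation_rotation (hPd j).toDerivation vy vz vpy vpz _ _ hy hz
    (c j α₂) (c j α₃)
  have dB3 (j : Fin 6) := derivation_rotation (hPd j).toDerivation vz vx vpz vpx _ _ hz hx
    (c j α₃) (c j α₁)
  simp only [IsPDeriv.toDerivation_apply, dx, dy, dz, dpx, dpy, dpz] at dH dA1 dA2 dB1 dB2 dB3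
  have hB1 : poisson Pd H B1 = 0 := by
    subst hH hB1
    simp only [poisson, HV, B1V, Jz, dH, dB1, Fin.reduceEq, if_true, if_false]
    field_simp
    ring
  have hB2 : poisson Pd H B2 = 0 := by
    subst hH hB2
    simp only [poisson, HV, B2V, Jx, dH, dB2, Fin.reduceEq, if_true, if_false]
    field_simp
    ring
  refine ⟨?_, ?_, hB1, hB2, ?_⟩
  · subst hH hA1
    simp only [poisson, HV, A1V, dH, dA1, Fin.reduceEq, if_true, if_false]
    ring
  · subst hH hA2
    simp only [poisson, HV, A2V, dH, dA2, Fin.reduceEq, if_true, if_false]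
    ring
  · subst_vars
    rw [FV_eq, poisson_add_right hPd, poisson_add_right hPd, hB1, hB2, zero_add, zero_add]
    simp only [poisson, HV, dH, dB3, Fin.reduceEq, if_true, if_false]
    field_simp
    ring
end
end

section
/- For the KKM potential V_I, the nested Poisson brackets satisfy the parafermionic-like quadratic relations {A₁,{A₁,B₁}} = −8A₁(A₁+A₂−H) − 16δB₁, {A₂,{A₂,B₂}} = −8A₂(A₁+A₂−H) − 16δB₂, and {B₁,{B₁,B₂}} = −8(B₁+2B₂−F+2α₂)B₁ − 16(α₁+α₂)B₂ + 16α₂F. -/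
noncomputable section

open MvPolynomial

section Bracket

variable {K : Type*} [Field K]

/-- An additive map on a field that satisfies the Leibniz rule, bundled as a derivation. -/
def Derivation.ofLeibniz (d : K → K) (hadd : ∀ f g, d (f + g) = d f + d g)
    (hmul : ∀ f g, d (f * g) = d f * g + f * d g) : Derivation ℤ K K :=
  Derivation.mk' (AddMonoidHom.mk' d hadd).toIntLinearMap fun f g => by
    simp [hmul, add_comm, mul_comm]

/-- The canonical bracket on a field with six derivations, the last three of which play the role
of the derivatives with respect to the momenta. -/
def canonicalBracket (D : Fin 6 → Derivation ℤ K K) (f g : K) : K :=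
  D 0 f * D 3 g + D 1 f * D 4 g + D 2 f * D 5 g - D 3 f * D 0 g - D 4 f * D 1 g - D 5 f * D 2 g

/-- `v` is a system of coordinates dual to the derivations `D`. -/
def IsDualSystem (D : Fin 6 → Derivation ℤ K K) (v : Fin 6 → K) : Prop :=
  ∀ i j, D i (v j) = if i = j then 1 else 0

theorem Derivation.map_div_sq (d : Derivation ℤ K K) (f g : K) :
    d (f / g ^ 2) = d f / g ^ 2 - 2 * f * d g / g ^ 3 := by
  rcases eq_or_ne g 0 with rfl | hg
  · simp
  · rw [Derivation.leibniz_div, Derivation.leibniz_pow]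
    simp only [smul_eq_mul, nsmul_eq_mul]
    field_simp
    push_cast
    ring

theorem Derivation.map_div_cube (d : Derivation ℤ K K) (f g : K) :
    d (f / g ^ 3) = d f / g ^ 3 - 3 * f * d g / g ^ 4 := by
  rcases eq_or_ne g 0 with rfl | hg
  · simp
  · rw [Derivation.leibniz_div, Derivation.leibniz_pow]
    simp only [smul_eq_mul, nsmul_eq_mul]
    field_simp
    push_cast
    ring

theorem Derivation.map_two (d : Derivation ℤ K K) : d 2 = 0 := by
  exact_mod_cast d.map_natCast 2

variable {D : Fin 6 → Derivation ℤ K K} {v : Fin 6 → K}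

theorem IsDualSystem.bracket_bracket_A₁_B₁ (hv : IsDualSystem D v) (h₀ : ∀ j, v j ≠ 0)
    {a b δ : K} (ha : ∀ i, D i a = 0) (hb : ∀ i, D i b = 0) (hδ : ∀ i, D i δ = 0) :
    let A := v 3 ^ 2 + δ * v 0 ^ 2 + a / v 0 ^ 2
    let B := (v 0 * v 4 - v 1 * v 3) ^ 2 + b * v 0 ^ 2 / v 1 ^ 2 + a * v 1 ^ 2 / v 0 ^ 2
    canonicalBracket D A (canonicalBracket D A B) =
      -8 * A * -(v 4 ^ 2 + δ * v 1 ^ 2 + b / v 1 ^ 2) - 16 * δ * B := by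
  have h0 := h₀ 0
  have h1 := h₀ 1
  simp [canonicalBracket, hv _ _, ha, hb, hδ, Derivation.map_div_sq,
    Derivation.map_div_cube, Derivation.map_two]
  field_simp
  ring

theorem IsDualSystem.bracket_bracket_A₂_B₂ (hv : IsDualSystem D v) (h₀ : ∀ j, v j ≠ 0)
    {b c δ : K} (hb : ∀ i, D i b = 0) (hc : ∀ i, D i c = 0) (hδ : ∀ i, D i δ = 0) :
    let A := v 5 ^ 2 + δ * v 2 ^ 2 + c / v 2 ^ 2
    let B := (v 1 * v 5 - v 2 * v 4) ^ 2 + c * v 1 ^ 2 / v 2 ^ 2 + b * v 2 ^ 2 / v 1 ^ 2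
    canonicalBracket D A (canonicalBracket D A B) =
      -8 * A * -(v 4 ^ 2 + δ * v 1 ^ 2 + b / v 1 ^ 2) - 16 * δ * B := by
  have h1 := h₀ 1
  have h2 := h₀ 2
  simp [canonicalBracket, hv _ _, hb, hc, hδ, Derivation.map_div_sq,
    Derivation.map_div_cube, Derivation.map_two]
  field_simp
  ring

theorem IsDualSystem.bracket_bracket_B₁_B₂ (hv : IsDualSystem D v) (h₀ : ∀ j, v j ≠ 0)
    {a b c : K} (ha : ∀ i, D i a = 0) (hb : ∀ i, D i b = 0) (hc : ∀ i, D i c = 0) :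
    let B₁ := (v 0 * v 4 - v 1 * v 3) ^ 2 + b * v 0 ^ 2 / v 1 ^ 2 + a * v 1 ^ 2 / v 0 ^ 2
    let B₂ := (v 1 * v 5 - v 2 * v 4) ^ 2 + c * v 1 ^ 2 / v 2 ^ 2 + b * v 2 ^ 2 / v 1 ^ 2
    let F := (v 1 * v 5 - v 2 * v 4) ^ 2 + (v 2 * v 3 - v 0 * v 5) ^ 2 +
      (v 0 * v 4 - v 1 * v 3) ^ 2 + b * (v 0 ^ 2 + v 2 ^ 2) / v 1 ^ 2 +
      (c * v 0 ^ 2 * (v 0 ^ 2 + v 1 ^ 2) + a * v 2 ^ 2 * (v 1 ^ 2 + v 2 ^ 2)) /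
        (v 0 ^ 2 * v 2 ^ 2)
    canonicalBracket D B₁ (canonicalBracket D B₁ B₂) =
      -8 * (B₁ + 2 * B₂ - F + 2 * b) * B₁ - 16 * (a + b) * B₂ + 16 * b * F := by
  have h0 := h₀ 0
  have h1 := h₀ 1
  have h2 := h₀ 2
  simp [canonicalBracket, hv _ _, ha, hb, hc, Derivation.map_div_sq,
    Derivation.map_div_cube, Derivation.map_two]
  field_simp
  ring

end Bracket

/-- The six coordinates `x, y, z, p_x, p_y, p_z` of `K6`. -/
def coordK6 (j : Fin 6) : K6 := toK6 (X j)

theorem coordK6_ne_zero (j : Fin 6) : coordK6 j ≠ 0 :=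
  (map_ne_zero_iff _ (IsFractionRing.injective (MvPolynomial (Fin 6) ℝ) K6)).2 (X_ne_zero j)

theorem kkm_VI_nested (α₁ α₂ α₃ δ : ℝ) (Pd : Fin 6 → K6 → K6)
    (hPd : ∀ j, IsPDeriv j (Pd j))
    (H A1 A2 B1 B2 F : K6)
    (hH : H = HV α₁ α₂ α₃ δ) (hA1 : A1 = A1V α₁ δ) (hA2 : A2 = A2V α₃ δ)
    (hB1 : B1 = B1V α₁ α₂) (hB2 : B2 = B2V α₂ α₃) (hF : F = FV α₁ α₂ α₃) :
    poisson Pd A1 (poisson Pd A1 B1) = -8 * A1 * (A1 + A2 - H) - 16 * cR δ * B1 ∧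
    poisson Pd A2 (poisson Pd A2 B2) = -8 * A2 * (A1 + A2 - H) - 16 * cR δ * B2 ∧
    poisson Pd B1 (poisson Pd B1 B2) =
      -8 * (B1 + 2 * B2 - F + 2 * cR α₂) * B1 - 16 * (cR α₁ + cR α₂) * B2
        + 16 * cR α₂ * F := by
  subst hH hA1 hA2 hB1 hB2 hF
  let D := fun j => Derivation.ofLeibniz (Pd j) (hPd j).1 (hPd j).2.1
  have hv : IsDualSystem D coordK6 := fun i j => by
    change Pd i (toK6 (X j)) = _
    rw [(hPd i).2.2, pderiv_X]
    by_cases h : i = j <;> simp [h, eq_comm]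
  have hc : ∀ (r : ℝ) (i : Fin 6), D i (cR r) = 0 := fun r i => by
    change Pd i (toK6 (C r)) = 0
    rw [(hPd i).2.2, pderiv_C, map_zero]
  have hS : A1V α₁ δ + A2V α₃ δ - HV α₁ α₂ α₃ δ =
      -(vpy ^ 2 + cR δ * vy ^ 2 + cR α₂ / vy ^ 2) := by
    simp only [A1V, A2V, HV]
    ring
  rw [hS]
  exact ⟨hv.bracket_bracket_A₁_B₁ coordK6_ne_zero (hc α₁) (hc α₂) (hc δ),
    hv.bracket_bracket_A₂_B₂ coordK6_ne_zero (hc α₂) (hc α₃) (hc δ),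
    hv.bracket_bracket_B₁_B₂ coordK6_ne_zero (hc α₁) (hc α₂) (hc α₃)⟩
end
end
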